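/- (Lemma 2) Every maximizer of V over (0, ∞) lies strictly between d and d + w: if σ* > 0 satisfies V(σ) ≤ V(σ*) for all σ > 0, then d < σ* < d + w. -/

import Mathlib

open Real MeasureTheory

/-- Gaussian density with mean 0 and standard deviation `σ`. -/
noncomputable def gauss (σ x : ℝ) : ℝ :=
  (1 / (σ * Real.sqrt (2 * Real.pi))) * Real.exp (-x ^ 2 / (2 * σ ^ 2))

/-- The value function determined by the Q-function `Q`. -/
noncomputable def V (Q : ℝ → ℝ) (σ : ℝ) : ℝ := ∫ x, gauss σ x * Q x

theorem integrable_continuous_mul {a b : ℝ} {Q f : ℝ → ℝ} (hf : Continuous f)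
    (hQmeas : Measurable Q) (hQbdd : ∃ C : ℝ, ∀ x, Q x ≤ C) (hQnonneg : ∀ x, 0 ≤ Q x)
    (hQsupp : ∀ x, x ∉ Set.Icc a b → Q x = 0) :
    Integrable (fun x => f x * Q x) := by
  obtain ⟨C, hC⟩ := hQbdd
  have hsupp : Function.support (fun x => f x * Q x) ⊆ Set.Icc a b := by
    intro x hx
    by_contra h
    exact hx (by simp [hQsupp x h])
  rw [← integrableOn_iff_integrable_of_support_subset hsupp]
  refine Integrable.mul_bdd (c := C) hf.continuousOn.integrableOn_Icc
    hQmeas.aestronglyMeasurable (Filter.Eventually.of_forall fun x => ?_)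
  rw [Real.norm_of_nonneg (hQnonneg x)]
  exact hC x

theorem continuous_gauss (σ : ℝ) : Continuous (gauss σ) := by
  unfold gauss
  fun_prop

theorem gauss_pos {σ : ℝ} (hσ : 0 < σ) (x : ℝ) : 0 < gauss σ x := by
  unfold gauss
  positivity

/-- Tangent-line bound for the Gaussian density under a change of scale. -/
theorem scale_mul_gauss_le {σ s : ℝ} (hσ : 0 < σ) (hs : 0 < s) (x : ℝ) :
    s * (gauss σ x + (1 - s ^ 2) / (2 * σ ^ 2) * (x ^ 2 * gauss σ x)) ≤ gauss (σ / s) x := by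
  have h2 : 0 < Real.sqrt (2 * Real.pi) := by positivity
  have hfac : gauss (σ / s) x =
      s * gauss σ x * Real.exp ((1 - s ^ 2) / (2 * σ ^ 2) * x ^ 2) := by
    unfold gauss
    have hexp : -x ^ 2 / (2 * (σ / s) ^ 2) =
        -x ^ 2 / (2 * σ ^ 2) + (1 - s ^ 2) / (2 * σ ^ 2) * x ^ 2 := by
      field_simp
      ring
    rw [hexp, Real.exp_add]
    field_simp
  rw [hfac]
  have h := mul_le_mul_of_nonneg_left
    (Real.add_one_le_exp ((1 - s ^ 2) / (2 * σ ^ 2) * x ^ 2))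
    (mul_pos hs (gauss_pos hσ x)).le
  linarith

/-- First-order optimality condition for a maximizer of `V Q`. -/
theorem integral_sq_sub_sq_mul_gauss_eq_zero {a b σ : ℝ} {Q : ℝ → ℝ}
    (hQmeas : Measurable Q) (hQbdd : ∃ C : ℝ, ∀ x, Q x ≤ C) (hQnonneg : ∀ x, 0 ≤ Q x)
    (hQsupp : ∀ x, x ∉ Set.Icc a b → Q x = 0) (hσ : 0 < σ)
    (hmax : ∀ τ : ℝ, 0 < τ → V Q τ ≤ V Q σ) :
    ∫ x, ((x ^ 2 - σ ^ 2) * gauss σ x) * Q x = 0 := by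
  have hint : ∀ τ, Integrable (fun x => gauss τ x * Q x) := fun τ =>
    integrable_continuous_mul (continuous_gauss τ) hQmeas hQbdd hQnonneg hQsupp
  have hint2 : Integrable (fun x => (x ^ 2 * gauss σ x) * Q x) :=
    integrable_continuous_mul ((continuous_id.pow 2).mul (continuous_gauss σ))
      hQmeas hQbdd hQnonneg hQsupp
  set M := ∫ x, (x ^ 2 * gauss σ x) * Q x with hM
  have hbound : ∀ s : ℝ, 0 < s → s * (V Q σ + (1 - s ^ 2) / (2 * σ ^ 2) * M) ≤ V Q σ := by
    intro s hs
    refine le_trans ?_ (hmax (σ / s) (div_pos hσ hs))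
    rw [hM, V, V, ← integral_const_mul, ← integral_add (hint σ) (hint2.const_mul _),
      ← integral_const_mul]
    refine integral_mono (((hint σ).add (hint2.const_mul _)).const_mul s) (hint _) fun x => ?_
    have h := mul_le_mul_of_nonneg_right (scale_mul_gauss_le hσ hs x) (hQnonneg x)
    refine le_trans (le_of_eq ?_) h
    ring
  have hloc : IsLocalMax (fun s : ℝ => s * (V Q σ + (1 - s ^ 2) / (2 * σ ^ 2) * M)) 1 := by
    filter_upwards [lt_mem_nhds (zero_lt_one (α := ℝ))] with s hs
    simpa using hbound s hs
  have hder : HasDerivAt (fun s : ℝ => s * (V Q σ + (1 - s ^ 2) / (2 * σ ^ 2) * M))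
      (V Q σ - M / σ ^ 2) 1 := by
    have h := (hasDerivAt_id (1 : ℝ)).mul
      ((((((hasDerivAt_id (1 : ℝ)).pow 2).const_sub 1).div_const (2 * σ ^ 2)).mul_const
        M).const_add (V Q σ))
    refine h.congr_deriv ?_
    simp
    field_simp
    ring
  have hzero := hloc.hasDerivAt_eq_zero hder
  have hMV : M = σ ^ 2 * V Q σ := by
    field_simp at hzero
    linarith
  have hsplit : ∀ x, ((x ^ 2 - σ ^ 2) * gauss σ x) * Q x =
      (x ^ 2 * gauss σ x) * Q x - σ ^ 2 * (gauss σ x * Q x) := fun x => by ring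
  simp_rw [hsplit]
  rw [integral_sub hint2 ((hint σ).const_mul _), integral_const_mul, ← hM, hMV, V, sub_self]

theorem ae_eq_zero_of_sq_sub_sq_mul {σ : ℝ} {Q : ℝ → ℝ} (hσ : 0 < σ)
    (h : ∀ᵐ x, ((x ^ 2 - σ ^ 2) * gauss σ x) * Q x = 0) : Q =ᵐ[volume] 0 := by
  filter_upwards [h, Measure.ae_ne volume σ, Measure.ae_ne volume (-σ)] with x hx h1 h2
  have h3 : x ^ 2 - σ ^ 2 ≠ 0 := by
    rw [sq_sub_sq]
    exact mul_ne_zero (fun h => h2 (by linarith)) (sub_ne_zero.2 h1)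
  simpa [h3, (gauss_pos hσ x).ne'] using hx

theorem maximizer_between (d w : ℝ) (hd : 0 < d) (hw : 0 < w) (Q : ℝ → ℝ)
    (hQmeas : Measurable Q) (hQbdd : ∃ C : ℝ, ∀ x, Q x ≤ C)
    (hQnonneg : ∀ x, 0 ≤ Q x)
    (hQsupp : ∀ x, x ∉ Set.Icc d (d + w) → Q x = 0)
    (hQne : ¬ (Q =ᵐ[volume] 0)) (σstar : ℝ) (hσstar : 0 < σstar)
    (hmax : ∀ σ : ℝ, 0 < σ → V Q σ ≤ V Q σstar) :
    d < σstar ∧ σstar < d + w := by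
  have hzero := integral_sq_sub_sq_mul_gauss_eq_zero hQmeas hQbdd hQnonneg hQsupp hσstar hmax
  have hint : Integrable (fun x => ((x ^ 2 - σstar ^ 2) * gauss σstar x) * Q x) :=
    integrable_continuous_mul
      (((continuous_id.pow 2).sub continuous_const).mul (continuous_gauss σstar))
      hQmeas hQbdd hQnonneg hQsupp
  constructor
  · by_contra! hle
    refine hQne (ae_eq_zero_of_sq_sub_sq_mul hσstar
      ((integral_eq_zero_iff_of_nonneg (fun x => ?_) hint).1 hzero))
    by_cases hx : x ∈ Set.Icc d (d + w)
    · have h : 0 ≤ x ^ 2 - σstar ^ 2 := by nlinarith [hx.1]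
      exact mul_nonneg (mul_nonneg h (gauss_pos hσstar x).le) (hQnonneg x)
    · simp [hQsupp x hx]
  · by_contra! hle
    have hzero' : ∫ x, -(((x ^ 2 - σstar ^ 2) * gauss σstar x) * Q x) = 0 := by
      rw [integral_neg, hzero, neg_zero]
    have hae := (integral_eq_zero_iff_of_nonneg (fun x => ?_) hint.neg).1 hzero'
    · refine hQne (ae_eq_zero_of_sq_sub_sq_mul hσstar ?_)
      filter_upwards [hae] with x hx
      exact neg_eq_zero.1 hx
    · by_cases hx : x ∈ Set.Icc d (d + w)
      · have h : x ^ 2 - σstar ^ 2 ≤ 0 := by nlinarith [hx.1, hx.2]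
        exact neg_nonneg.2 (mul_nonpos_of_nonpos_of_nonneg
          (mul_nonpos_of_nonpos_of_nonneg h (gauss_pos hσstar x).le) (hQnonneg x))
      · simp [hQsupp x hx]
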